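/- Let c and a be positive integers. There exists a polyunsaturated SGK graph G with clique number c and independence number a if and only if a ≥ c - 2. Moreover, G may be chosen so that both G and its complement are comparability graphs. -/

import Mathlib

/-- `s` is an independent set of the graph `G`. -/
def IndepSet {V : Type*} (G : SimpleGraph V) (s : Set V) : Prop :=
  ∀ ⦃v⦄, v ∈ s → ∀ ⦃w⦄, w ∈ s → ¬ G.Adj v w

/-- `α_k(G)`: the maximum number of vertices in a union of `k` independent sets. -/
noncomputable def alphak {V : Type*} (G : SimpleGraph V) (k : ℕ) : ℕ :=
  sSup {n | ∃ A : Fin k → Set V, (∀ i, IndepSet G (A i)) ∧ (⋃ i, A i).ncard = n}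

/-- `ω_k(G)`: the maximum number of vertices in a union of `k` cliques. -/
noncomputable def omegak {V : Type*} (G : SimpleGraph V) (k : ℕ) : ℕ :=
  sSup {n | ∃ A : Fin k → Set V, (∀ i, G.IsClique (A i)) ∧ (⋃ i, A i).ncard = n}

/-- The clique number `ω(G)`. -/
noncomputable def cliqueNumber {V : Type*} (G : SimpleGraph V) : ℕ :=
  sSup {n | ∃ s : Set V, G.IsClique s ∧ s.ncard = n}

/-- The independence number `α(G)`. -/
noncomputable def indepNumber {V : Type*} (G : SimpleGraph V) : ℕ :=
  sSup {n | ∃ s : Set V, IndepSet G s ∧ s.ncard = n}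

/-- `f` encodes a partition of the vertices of `G` into cliques:
its (nonempty) fibers are the cliques. -/
def IsCliquePartition {V : Type*} (G : SimpleGraph V) (f : V → V) : Prop :=
  ∀ i : V, G.IsClique (f ⁻¹' {i})

/-- The `k`-norm of the partition encoded by `f`: `Σ_C min (k, |C|)`. -/
noncomputable def knorm {V : Type*} [Fintype V] (f : V → V) (k : ℕ) : ℕ :=
  ∑ i : V, min k (f ⁻¹' {i}).ncard

/-- `G` is a strong Greene–Kleitman (SGK) graph: every induced subgraph has, for every
positive `k`, a clique partition that is simultaneously `k`- and `k+1`-saturated. -/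
def SGK {V : Type*} [Fintype V] (G : SimpleGraph V) : Prop :=
  ∀ (s : Finset V) (k : ℕ), 0 < k →
    ∃ f : (↑s : Set V) → (↑s : Set V),
      IsCliquePartition (G.induce ↑s) f ∧
      knorm f k = alphak (G.induce ↑s) k ∧
      knorm f (k + 1) = alphak (G.induce ↑s) (k + 1)

/-- An SGK graph is polyunsaturated if no clique partition is simultaneously `k`- and
`l`-saturated for distinct nonconsecutive positive `k, l` below the clique number. -/
def PolyunsatG {V : Type*} [Fintype V] (G : SimpleGraph V) : Prop :=
  ∀ k l : ℕ, 0 < k → 0 < l → k < cliqueNumber G → l < cliqueNumber G →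
    (k + 2 ≤ l ∨ l + 2 ≤ k) →
    ¬ ∃ f : V → V, IsCliquePartition G f ∧ knorm f k = alphak G k ∧ knorm f l = alphak G l

/-- `G` is a comparability graph: adjacency is comparability in some partial order. -/
def IsComparabilityGraph {V : Type*} (G : SimpleGraph V) : Prop :=
  ∃ r : V → V → Prop, IsPartialOrder V r ∧ ∀ v w, G.Adj v w ↔ (v ≠ w ∧ (r v w ∨ r w v))

section KFamilies

variable {V : Type*} [Fintype V] {G : SimpleGraph V}

theorem bddAbove_indepUnions (G : SimpleGraph V) (k : ℕ) :
    BddAbove {n | ∃ A : Fin k → Set V, (∀ i, IndepSet G (A i)) ∧ (⋃ i, A i).ncard = n} := by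
  refine ⟨Nat.card V, ?_⟩
  rintro n ⟨A, -, rfl⟩
  exact Set.ncard_le_card _

theorem ncard_iUnion_le_alphak {k : ℕ} {A : Fin k → Set V} (hA : ∀ i, IndepSet G (A i)) :
    (⋃ i, A i).ncard ≤ alphak G k :=
  le_csSup (bddAbove_indepUnions G k) ⟨A, hA, rfl⟩

theorem exists_ncard_iUnion_eq_alphak (G : SimpleGraph V) (k : ℕ) :
    ∃ A : Fin k → Set V, (∀ i, IndepSet G (A i)) ∧ (⋃ i, A i).ncard = alphak G k :=
  Nat.sSup_mem (s := {n | ∃ A : Fin k → Set V, (∀ i, IndepSet G (A i)) ∧ (⋃ i, A i).ncard = n})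
    ⟨_, fun _ => ∅, fun _ _ h => h.elim, rfl⟩ (bddAbove_indepUnions G k)

/-- A clique meets a union of `k` independent sets in at most as many vertices as the number of
those sets that it meets. -/
theorem ncard_inter_iUnion_le {V : Type*} {G : SimpleGraph V} {k : ℕ} {A : Fin k → Set V}
    (hA : ∀ i, IndepSet G (A i)) {C : Set V} (hC : G.IsClique C) :
    (C ∩ ⋃ i, A i).ncard ≤ {i | (C ∩ A i).Nonempty}.ncard := by
  classical
  have hidx : ∀ v : V, ∃ i : Option (Fin k), v ∈ ⋃ i, A i → ∃ j, i = some j ∧ v ∈ A j := by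
    intro v
    by_cases hv : v ∈ ⋃ i, A i
    · obtain ⟨j, hj⟩ := Set.mem_iUnion.1 hv
      exact ⟨some j, fun _ => ⟨j, rfl, hj⟩⟩
    · exact ⟨none, fun h => (hv h).elim⟩
  choose idx hidx using hidx
  rw [← Set.ncard_image_of_injective {i | (C ∩ A i).Nonempty} (Option.some_injective (Fin k))]
  refine Set.ncard_le_ncard_of_injOn idx ?_ ?_ (Set.toFinite _)
  · rintro v ⟨hvC, hvU⟩
    obtain ⟨j, hj, hvj⟩ := hidx v hvU
    exact ⟨j, ⟨v, hvC, hvj⟩, hj.symm⟩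
  · rintro v ⟨hvC, hvU⟩ w ⟨hwC, hwU⟩ hvw
    obtain ⟨j, hj, hvj⟩ := hidx v hvU
    obtain ⟨j', hj', hwj⟩ := hidx w hwU
    obtain rfl : j = j' := by simpa [hj, hj'] using hvw
    by_contra hne
    exact hA j hvj hwj (hC hvC hwC hne)

theorem ncard_inter_iUnion_le_min {k : ℕ} {A : Fin k → Set V} (hA : ∀ i, IndepSet G (A i))
    {C : Set V} (hC : G.IsClique C) : (C ∩ ⋃ i, A i).ncard ≤ min k C.ncard := by
  refine le_min ((ncard_inter_iUnion_le hA hC).trans ?_) (Set.ncard_le_ncard Set.inter_subset_left)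
  simpa using Set.ncard_le_card {i | (C ∩ A i).Nonempty}

theorem sum_ncard_fiber_inter {ι : Type*} [Fintype ι] (g : V → ι) (U : Set V) :
    ∑ i, (g ⁻¹' {i} ∩ U).ncard = U.ncard := by
  classical
  rw [Set.ncard_eq_toFinset_card' U,
    Finset.card_eq_sum_card_fiberwise (f := g) (t := Finset.univ) (by simp)]
  refine Finset.sum_congr rfl fun i _ => ?_
  rw [Set.ncard_eq_toFinset_card']
  congr 1
  ext v
  simp [and_comm]

/-- The weak duality between clique partitions and unions of `k` independent sets. -/
theorem alphak_le_sum_min {ι : Type*} [Fintype ι] {g : V → ι}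
    (hg : ∀ i, G.IsClique (g ⁻¹' {i})) (k : ℕ) :
    alphak G k ≤ ∑ i, min k (g ⁻¹' {i}).ncard := by
  obtain ⟨A, hA, h⟩ := exists_ncard_iUnion_eq_alphak G k
  rw [← h, ← sum_ncard_fiber_inter g]
  exact Finset.sum_le_sum fun i _ => ncard_inter_iUnion_le_min hA (hg i)

theorem alphak_le_knorm {f : V → V} (hf : IsCliquePartition G f) (k : ℕ) :
    alphak G k ≤ knorm f k :=
  alphak_le_sum_min hf k

/-- Complementary slackness: suppose the levels `0, …, k - 1` of `lev` are independent and a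
clique partition `g` certifies that their union is a maximum `k`-family. Then a clique of a
`k`-saturated partition that leaves this union meets each of its levels. -/
theorem exists_level_of_saturated {ι : Type*} [Fintype ι] {k : ℕ} {lev : V → ℕ}
    (hlev : ∀ v w, lev v = lev w → lev v < k → ¬ G.Adj v w)
    {g : V → ι} (hg : ∀ i, G.IsClique (g ⁻¹' {i}))
    (hcert : ∀ i, (∀ v, g v = i → lev v < k) ∨ ∀ p < k, ∃ v, g v = i ∧ lev v = p)
    {f : V → V} (hf : IsCliquePartition G f) (hsat : knorm f k = alphak G k)
    {v : V} (hv : k ≤ lev v) {p : ℕ} (hp : p < k) : ∃ w, f w = f v ∧ lev w = p := by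
  classical
  set A : Fin k → Set V := fun i => {v | lev v = i} with hAdef
  have hA : ∀ i, IndepSet G (A i) := by
    intro i v hv w hw
    simp only [hAdef, Set.mem_ofPred_eq] at hv hw
    exact hlev v w (hv.trans hw.symm) (hv ▸ i.2)
  have hU : ∀ v, v ∈ ⋃ i, A i ↔ lev v < k := by
    intro v
    simp only [hAdef, Set.mem_iUnion, Set.mem_ofPred_eq]
    exact ⟨fun ⟨i, hi⟩ => hi ▸ i.2, fun h => ⟨⟨_, h⟩, rfl⟩⟩
  have hcert' : ∀ i, min k (g ⁻¹' {i}).ncard ≤ (g ⁻¹' {i} ∩ ⋃ i, A i).ncard := by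
    intro i
    rcases hcert i with h | h
    · rw [Set.inter_eq_left.2 (fun v hv => (hU v).2 (h v hv) : g ⁻¹' {i} ⊆ ⋃ i, A i)]
      exact min_le_right _ _
    · refine (min_le_left _ _).trans ?_
      choose r hr using fun p : Fin k => h p p.2
      have hinj : Function.Injective r := fun p q hpq => by
        ext
        rw [← (hr p).2, ← (hr q).2, hpq]
      calc k = (Set.range r).ncard := by
            rw [← Set.image_univ, Set.ncard_image_of_injective _ hinj]; simp
        _ ≤ _ := by
            refine Set.ncard_le_ncard ?_
            rintro _ ⟨p, rfl⟩
            exact ⟨(hr p).1, (hU _).2 ((hr p).2 ▸ p.2)⟩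
  have hle : ∀ i ∈ Finset.univ, (f ⁻¹' {i} ∩ ⋃ i, A i).ncard ≤ min k (f ⁻¹' {i}).ncard :=
    fun i _ => ncard_inter_iUnion_le_min hA (hf i)
  have hsum : ∑ i, (f ⁻¹' {i} ∩ ⋃ i, A i).ncard = ∑ i, min k (f ⁻¹' {i}).ncard := by
    refine le_antisymm (Finset.sum_le_sum hle) ?_
    rw [sum_ncard_fiber_inter, ← sum_ncard_fiber_inter g]
    exact (hsat.le.trans (alphak_le_sum_min hg k)).trans
      (Finset.sum_le_sum fun i _ => hcert' i)
  have heq := (Finset.sum_eq_sum_iff_of_le hle).1 hsum (f v) (Finset.mem_univ _)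
  have hlt : (f ⁻¹' {f v} ∩ ⋃ i, A i).ncard < (f ⁻¹' {f v}).ncard := by
    refine Set.ncard_lt_ncard ⟨Set.inter_subset_left, fun h => ?_⟩
    exact absurd ((hU v).1 (h rfl).2) (by omega)
  have hk : k ≤ {i | (f ⁻¹' {f v} ∩ A i).Nonempty}.ncard := by
    have := ncard_inter_iUnion_le hA (hf (f v))
    omega
  have huniv : {i | (f ⁻¹' {f v} ∩ A i).Nonempty} = Set.univ := by
    refine Set.eq_of_subset_of_ncard_le (Set.subset_univ _) ?_
    simpa using hk
  obtain ⟨w, hw, hwA⟩ := huniv.symm ▸ Set.mem_univ (⟨p, hp⟩ : Fin k)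
  exact ⟨w, hw, hwA⟩

end KFamilies

section GreeneKleitman

/-- Egerváry's theorem on integral dual solutions of the assignment problem, with the allowed
pairs given by a reflexive relation `R`. -/
theorem exists_perm_tight_potentials {E : Type*} [Fintype E] (R : E → E → Prop) (w : E → E → ℤ)
    (hR : ∀ x, R x x) :
    ∃ (σ : Equiv.Perm E) (u v : E → ℤ), (∀ x y, R x y → u x + v y ≤ w x y) ∧
      ∀ x, R x (σ x) ∧ u x + v (σ x) = w x (σ x) := by
  classical
  obtain ⟨z, ⟨u, v, hfeas, hz⟩, hmax⟩ := Int.exists_greatest_of_bdd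
    (P := fun z => ∃ u v : E → ℤ, (∀ x y, R x y → u x + v y ≤ w x y) ∧ ∑ x, u x + ∑ x, v x = z)
    ⟨∑ x, w x x, by
      rintro _ ⟨u, v, h, rfl⟩
      rw [← Finset.sum_add_distrib]
      exact Finset.sum_le_sum fun x _ => h x x (hR x)⟩
    ⟨_, fun x => -∑ y, |w x y|, fun _ => 0, fun x y _ => by
      have := Finset.single_le_sum (f := fun y => |w x y|) (fun y _ => abs_nonneg _)
        (Finset.mem_univ y)
      have h2 := neg_abs_le (w x y)
      simp only at this ⊢
      linarith, rfl⟩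
  let t : E → Finset E := fun x => Finset.univ.filter fun y => R x y ∧ u x + v y = w x y
  obtain ⟨σ, hinj, hσ⟩ := (Finset.all_card_le_biUnion_card_iff_exists_injective t).1 (by
    intro X
    by_contra! hX
    let u' : E → ℤ := fun x => u x + if x ∈ X then 1 else 0
    let v' : E → ℤ := fun y => v y - if y ∈ X.biUnion t then 1 else 0
    have hbetter := hmax _ ⟨u', v', fun x y hxy => by
      have h1 := hfeas x y hxy
      by_cases hx : x ∈ X
      · by_cases hy : y ∈ X.biUnion t
        · simp only [u', v', hx, hy, if_true]
          linarith
        · have h2 : u x + v y ≠ w x y := fun h =>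
            hy (Finset.mem_biUnion.2 ⟨x, hx, by simp [t, hxy, h]⟩)
          simp only [u', v', hx, hy, if_true, if_false]
          omega
      · simp only [u', v', hx, if_false]
        split_ifs <;> omega, rfl⟩
    simp only [u', v', Finset.sum_add_distrib, Finset.sum_sub_distrib, Finset.sum_ite_mem,
      Finset.univ_inter, Finset.sum_const, nsmul_eq_mul, mul_one] at hbetter
    have : ((X.biUnion t).card : ℤ) < X.card := by exact_mod_cast hX
    linarith)
  refine ⟨Equiv.ofBijective σ (Finite.injective_iff_bijective.1 hinj), u, v, hfeas, fun x => ?_⟩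
  simpa [t] using hσ x

variable {V : Type*} [Fintype V]

/-- Optimal chain systems for the cost `k + (k + 1)` per chain and `2` per uncovered element, with
an integral dual solution. A system is encoded by the predecessor permutation `π`: uncovered
elements are fixed, and the minimal elements of the chains have predecessors in the second
summand. The dual solution assigns to `p` the interval from `t p` to `b p`. -/
theorem exists_chains_and_intervals {r : V → V → Prop} (hirr : ∀ p, ¬ r p p) (k : ℕ) :
    ∃ (ι : Type) (_ : Fintype ι) (π : Equiv.Perm (V ⊕ ι)) (t b : V → ℤ),
      (∀ p, 0 ≤ t p) ∧ (∀ p, b p ≤ 2 * k + 1) ∧ (∀ p, b p ≤ t p + 2) ∧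
      (∀ p q, r p q → b q ≤ t p) ∧
      (∀ p, π (.inl p) = .inl p → b p = t p + 2) ∧
      (∀ p q, π (.inl q) = .inl p → p ≠ q → r p q ∧ b q = t p) ∧
      (∀ q s, π (.inl q) = .inr s → b q = 2 * k + 1) ∧
      (∀ s p, π (.inr s) = .inl p → t p = 0) := by
  classical
  let ι := Fin (Fintype.card V + 1)
  let R : V ⊕ ι → V ⊕ ι → Prop
    | .inl p, .inl q => p = q ∨ r p q
    | _, _ => True
  let w : V ⊕ ι → V ⊕ ι → ℤ
    | .inl p, .inl q => if p = q then 2 else 0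
    | .inr _, .inl _ => 2 * k + 1
    | _, .inr _ => 0
  obtain ⟨σ, u, v, hfeas, hσ⟩ := exists_perm_tight_potentials R w (by
    rintro (p | s)
    · exact Or.inl rfl
    · trivial)
  obtain ⟨s₀, s₁, hs⟩ : ∃ s₀ s₁ : ι, σ (.inr s₀) = .inr s₁ := by
    by_contra! h
    have h' : ∀ s : ι, ∃ p : V, σ (.inr s) = .inl p := fun s => by
      rcases hq : σ (.inr s) with p | s'
      · exact ⟨p, rfl⟩
      · exact (h s s' hq).elim
    choose F hF using h'
    have hinj : Function.Injective F := fun s s' hss => by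
      have : σ (.inr s) = σ (.inr s') := by rw [hF, hF, hss]
      simpa using this
    simpa [ι] using Fintype.card_le_of_injective F hinj
  have h01 : u (.inr s₀) + v (.inr s₁) = 0 := by simpa [hs, w] using (hσ (.inr s₀)).2
  have hVS : ∀ p s, u (.inl p) + v (.inr s) ≤ 0 := fun p s => hfeas (.inl p) (.inr s) trivial
  have hSS : ∀ s s', u (.inr s) + v (.inr s') ≤ 0 := fun s s' =>
    hfeas (.inr s) (.inr s') trivial
  have hSV : ∀ s p, u (.inr s) + v (.inl p) ≤ 2 * k + 1 := fun s p =>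
    hfeas (.inr s) (.inl p) trivial
  have hVV : ∀ p, u (.inl p) + v (.inl p) ≤ 2 := fun p => by
    simpa [w] using hfeas (.inl p) (.inl p) (Or.inl rfl)
  have hlt : ∀ p q, r p q → u (.inl p) + v (.inl q) ≤ 0 := fun p q h => by
    have hne : p ≠ q := fun e => hirr p (by simpa [e] using h)
    simpa [w, hne] using hfeas (.inl p) (.inl q) (Or.inr h)
  refine ⟨ι, inferInstance, σ.symm, fun p => - u (.inl p) - v (.inr s₁),
    fun p => v (.inl p) - v (.inr s₁), fun p => ?_, fun p => ?_, fun p => ?_, fun p q h => ?_,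
    fun p h => ?_, fun p q h hne => ?_, fun q s h => ?_, fun s p h => ?_⟩
  · linarith [hVS p s₁]
  · linarith [hSV s₀ p]
  · linarith [hVV p]
  · linarith [hlt p q h]
  · rw [Equiv.symm_apply_eq] at h
    have := (hσ (.inl p)).2
    simp only [← h, w, if_true] at this
    linarith
  · rw [Equiv.symm_apply_eq] at h
    have h1 := hσ (.inl p)
    simp only [← h, w, R, hne, if_false, false_or] at h1
    exact ⟨h1.1, by linarith [h1.2]⟩
  · rw [Equiv.symm_apply_eq] at h
    have := (hσ (.inr s)).2
    simp only [← h, w] at this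
    linarith [hSV s₀ q, hSS s s₁]
  · rw [Equiv.symm_apply_eq] at h
    have := (hσ (.inl p)).2
    simp only [← h, w] at this
    linarith [hVS p s₁, hSS s₀ s]

variable {G : SimpleGraph V}

theorem ncard_eq_sum_ite (P : V → Prop) [DecidablePred P] :
    ({x | P x}.ncard : ℤ) = ∑ x, if P x then 1 else 0 := by
  rw [Set.ncard_eq_toFinset_card', Finset.sum_boole]
  congr 2
  ext
  simp

/-- The lower bound on `alphak` obtained from the intervals at the thresholds `θ`. -/
theorem le_alphak_of_intervals {r : V → V → Prop}
    (hG : ∀ v w, G.Adj v w ↔ r v w ∨ r w v) {ι : Type*} [Fintype ι] {π : Equiv.Perm (V ⊕ ι)}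
    {t b : V → ℤ} {K : ℤ} (hbt : ∀ p, b p ≤ t p + 2)
    (hr : ∀ p q, r p q → b q ≤ t p)
    (hstep : ∀ p q, π (.inl q) = .inl p → p ≠ q → r p q ∧ b q = t p)
    (hstart : ∀ q s, π (.inl q) = .inr s → b q = K)
    (hend : ∀ s p, π (.inr s) = .inl p → t p = 0)
    {k : ℕ} {θ : Fin k → ℤ} (hθ : ∀ i, 0 < θ i ∧ θ i ≤ K)
    (hθ2 : ∀ i j, θ i < θ j + 2 → θ j < θ i + 2 → i = j)
    (hfix : ∀ p, π (.inl p) = .inl p → ∃ i, t p < θ i ∧ θ i ≤ b p) :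
    k * {p : V | ∃ s, π (.inl p) = .inr s}.ncard + {p : V | π (.inl p) = .inl p}.ncard
      ≤ alphak G k := by
  classical
  let A : Fin k → Set V := fun i => {p | t p < θ i ∧ θ i ≤ b p}
  have hA : ∀ i, IndepSet G (A i) := by
    rintro i p ⟨hp1, hp2⟩ q ⟨hq1, hq2⟩ hadj
    rcases (hG p q).1 hadj with h | h
    · linarith [hr p q h]
    · linarith [hr q p h]
  have hdisj : Pairwise (Function.onFun Disjoint A) := by
    intro i j hij
    refine Set.disjoint_left.2 ?_
    rintro p ⟨hp1, hp2⟩ ⟨hq1, hq2⟩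
    exact hij (hθ2 i j (by linarith [hbt p]) (by linarith [hbt p]))
  have hlevel : ∀ i, {p : V | ∃ s, π (.inl p) = .inr s}.ncard +
      (A i ∩ {p : V | π (.inl p) = .inl p}).ncard ≤ (A i).ncard := by
    intro i
    let β : V ⊕ ι → ℤ := Sum.elim (fun p => if θ i ≤ b p then 1 else 0) fun _ => 0
    let τ : V ⊕ ι → ℤ := Sum.elim (fun p => if θ i ≤ t p then 1 else 0) fun _ => 0
    have hcount : ∑ x, (β x - τ x) = ∑ x, (β x - τ (π x)) := by
      rw [Finset.sum_sub_distrib, Finset.sum_sub_distrib, Equiv.sum_comp π τ]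
    have hlhs : ∑ x, (β x - τ x) ≤ ∑ p : V, if p ∈ A i then (1 : ℤ) else 0 := by
      rw [Fintype.sum_sum_type]
      simp only [β, τ, Sum.elim_inr, sub_self, Finset.sum_const_zero, add_zero, Sum.elim_inl]
      refine Finset.sum_le_sum fun p _ => ?_
      simp only [A, Set.mem_ofPred_eq]
      split_ifs <;> omega
    have hrhs : ∑ p : V, ((if ∃ s, π (.inl p) = .inr s then (1 : ℤ) else 0) +
        if p ∈ A i ∩ {p : V | π (.inl p) = .inl p} then 1 else 0) ≤ ∑ x, (β x - τ (π x)) := by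
      rw [Fintype.sum_sum_type]
      have hzero : ∑ s : ι, (β (.inr s) - τ (π (.inr s))) = 0 := by
        refine Finset.sum_eq_zero fun s _ => ?_
        rcases h : π (.inr s) with p | s'
        · have := (hθ i).1
          simp [β, τ, hend s p h, this]
        · simp [β, τ]
      rw [hzero, add_zero]
      refine Finset.sum_le_sum fun p _ => ?_
      obtain ⟨x, h⟩ : ∃ x, π (.inl p) = x := ⟨_, rfl⟩
      rcases x with q | s
      · by_cases hqp : q = p
        · subst hqp
          simp only [A, Set.mem_ofPred_eq, Set.mem_inter_iff, β, τ, Sum.elim_inl, h]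
          simp only [reduceCtorEq, exists_false, if_false, and_true]
          have := hbt q
          obtain ⟨j, hj⟩ := hfix q h
          split_ifs <;> omega
        · have hb := (hstep q p h hqp).2
          simp [β, τ, h, hqp, hb]
      · have hb := hstart p s h
        have := (hθ i).2
        simp [β, τ, h, hb, this]
    have htot := (hrhs.trans hcount.ge).trans hlhs
    rw [Finset.sum_add_distrib] at htot
    have h1 := ncard_eq_sum_ite fun p : V => ∃ s, π (.inl p) = .inr s
    have h2 := ncard_eq_sum_ite fun p => p ∈ A i ∩ {p : V | π (.inl p) = .inl p}
    have h3 := ncard_eq_sum_ite fun p => p ∈ A i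
    rw [← h1, ← h2, ← h3] at htot
    exact_mod_cast htot
  calc _ ≤ ∑ i, ({p : V | ∃ s, π (.inl p) = .inr s}.ncard +
      (A i ∩ {p : V | π (.inl p) = .inl p}).ncard) := by
        rw [Finset.sum_add_distrib]
        simp only [Finset.sum_const, Finset.card_univ, Fintype.card_fin, smul_eq_mul]
        refine Nat.add_le_add_left ?_ _
        rw [← finsum_eq_sum_of_fintype, ← Set.ncard_iUnion_of_finite (fun i => Set.toFinite _)
          (hdisj.mono fun i j h => h.mono Set.inter_subset_left Set.inter_subset_left)]
        refine Set.ncard_le_ncard fun p hp => ?_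
        obtain ⟨i, hi⟩ := hfix p hp
        exact Set.mem_iUnion.2 ⟨i, hi, hp⟩
    _ ≤ ∑ i, (A i).ncard := Finset.sum_le_sum fun i _ => hlevel i
    _ = (⋃ i, A i).ncard := by
        rw [Set.ncard_iUnion_of_finite (fun i => Set.toFinite _) hdisj, finsum_eq_sum_of_fintype]
    _ ≤ alphak G k := ncard_iUnion_le_alphak hA

/-- The cycles of a predecessor permutation yield a partition into chains. -/
theorem exists_chain_partition {r : V → V → Prop} (hirr : ∀ p, ¬ r p p)
    (htrans : ∀ p q s, r p q → r q s → r p s) (hG : ∀ v w, G.Adj v w ↔ r v w ∨ r w v)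
    {ι : Type*} {π : Equiv.Perm (V ⊕ ι)}
    (hstep : ∀ p q, π (.inl q) = .inl p → p ≠ q → r p q) :
    ∃ f : V → V, IsCliquePartition G f ∧ ∀ k : ℕ, 0 < k → knorm f k ≤
      k * {p : V | ∃ s, π (.inl p) = .inr s}.ncard + {p : V | π (.inl p) = .inl p}.ncard := by
  classical
  let step : V → V → Prop := fun p q => π (.inl q) = .inl p ∧ p ≠ q
  have hlt : ∀ {p q}, Relation.ReflTransGen step p q → p = q ∨ r p q := by
    intro p q h
    induction h with
    | refl => exact Or.inl rfl
    | tail _ h ih =>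
      have h' := hstep _ _ h.1 h.2
      rcases ih with rfl | ih
      · exact Or.inr h'
      · exact Or.inr (htrans _ _ _ ih h')
  have hwf : WellFounded r :=
    haveI : IsTrans V r := ⟨htrans⟩
    haveI : Std.Irrefl r := ⟨hirr⟩
    Finite.wellFounded_of_trans_of_irrefl r
  have hroot : ∀ p, ∃ i, (∀ q, ¬ step q i) ∧ Relation.ReflTransGen step i p := by
    intro p
    induction p using hwf.induction with
    | _ p ih =>
      by_cases h : ∃ q, step q p
      · obtain ⟨q, hq⟩ := h
        obtain ⟨i, hi, hiq⟩ := ih q (hstep _ _ hq.1 hq.2)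
        exact ⟨i, hi, hiq.tail hq⟩
      · exact ⟨p, not_exists.1 h, .refl⟩
  choose f hf hfp using hroot
  have huniq : Relator.RightUnique step := by
    intro p q q' h h'
    have : (Sum.inl q : V ⊕ ι) = .inl q' := π.injective (h.1.trans h'.1.symm)
    simpa using this
  have hclique : IsCliquePartition G f := by
    intro i p hp q hq hne
    have hip : Relation.ReflTransGen step i p := by simpa [show f p = i from hp] using hfp p
    have hiq : Relation.ReflTransGen step i q := by simpa [show f q = i from hq] using hfp q
    rw [hG]
    rcases Relation.ReflTransGen.total_of_right_unique huniq hip hiq with h | h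
    · exact Or.inl ((hlt h).resolve_left hne)
    · exact Or.inr ((hlt h).resolve_left hne.symm)
  refine ⟨f, hclique, fun k hk => ?_⟩
  have hbound : ∀ i, min k (f ⁻¹' {i}).ncard ≤
      (if ∃ s, π (.inl i) = .inr s then k else 0) + if π (.inl i) = .inl i then 1 else 0 := by
    intro i
    rcases (f ⁻¹' {i}).eq_empty_or_nonempty with h | ⟨p, hp⟩
    · simp [h]
    have hi : ∀ q, ¬ step q i := by simpa [show f p = i from hp] using hf p
    obtain ⟨x, h⟩ : ∃ x, π (.inl i) = x := ⟨_, rfl⟩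
    rcases x with q | s
    · obtain rfl : q = i := by
        by_contra hne
        exact hi q ⟨h, hne⟩
      have hsub : f ⁻¹' {q} ⊆ {q} := by
        intro p hp
        have hqp : Relation.ReflTransGen step q p := by simpa [show f p = q from hp] using hfp p
        rcases Relation.ReflTransGen.cases_head hqp with rfl | ⟨s, hs, -⟩
        · rfl
        · have : (Sum.inl s : V ⊕ ι) = .inl q := π.injective (hs.1.trans h.symm)
          exact absurd (by simpa using this.symm) hs.2
      have := Set.ncard_le_ncard hsub
      simp only [Set.ncard_singleton] at this
      simp [h, this]
    · simp [h]
  refine (Finset.sum_le_sum fun i _ => hbound i).trans (le_of_eq ?_)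
  rw [Finset.sum_add_distrib, ← Finset.sum_filter, ← Finset.sum_filter, Finset.sum_const,
    Finset.sum_const, Set.ncard_eq_toFinset_card', Set.ncard_eq_toFinset_card']
  simp [mul_comm]

/-- The Greene–Kleitman theorem for a finite strict order. -/
theorem exists_saturated_of_strictOrder {r : V → V → Prop} (hirr : ∀ p, ¬ r p p)
    (htrans : ∀ p q s, r p q → r q s → r p s) (hG : ∀ v w, G.Adj v w ↔ r v w ∨ r w v)
    {k : ℕ} (hk : 0 < k) :
    ∃ f : V → V, IsCliquePartition G f ∧ knorm f k = alphak G k ∧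
      knorm f (k + 1) = alphak G (k + 1) := by
  obtain ⟨ι, _, π, t, b, ht, hb, hbt, hr, hfix, hstep, hstart, hend⟩ :=
    exists_chains_and_intervals hirr k
  obtain ⟨f, hf, hnorm⟩ := exists_chain_partition hirr htrans hG
    (π := π) fun p q h hne => (hstep p q h hne).1
  refine ⟨f, hf, le_antisymm ((hnorm k hk).trans ?_) (alphak_le_knorm hf k),
    le_antisymm ((hnorm (k + 1) k.succ_pos).trans ?_) (alphak_le_knorm hf (k + 1))⟩
  · refine le_alphak_of_intervals hG hbt hr hstep hstart hend (θ := fun i => 2 * (i : ℤ) + 2)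
      (fun i => by omega) (fun i j h1 h2 => by omega) fun p hp => ?_
    have h1 := hfix p hp
    have h2 := hb p
    have h3 := ht p
    exact ⟨⟨(t p / 2).toNat, by omega⟩, by simp only; omega, by simp only; omega⟩
  · refine le_alphak_of_intervals hG hbt hr hstep hstart hend (θ := fun i => 2 * (i : ℤ) + 1)
      (fun i => by omega) (fun i j h1 h2 => by omega) fun p hp => ?_
    have h1 := hfix p hp
    have h2 := hb p
    have h3 := ht p
    exact ⟨⟨((t p + 1) / 2).toNat, by omega⟩, by simp only; omega, by simp only; omega⟩

theorem IsComparabilityGraph.sgk (h : IsComparabilityGraph G) : SGK G := by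
  obtain ⟨r, hr, hG⟩ := h
  intro s k hk
  refine exists_saturated_of_strictOrder (r := fun v w : (↑s : Set V) => v ≠ w ∧ r v w)
    (fun p h => h.1 rfl) (fun p q s h h' => ⟨?_, hr.trans _ _ _ h.2 h'.2⟩) (fun v w => ?_) hk
  · rintro rfl
    exact h.1 (Subtype.ext (hr.antisymm _ _ h.2 h'.2))
  · rw [SimpleGraph.induce_adj, hG]
    have : (v : V) ≠ w ↔ v ≠ w := Subtype.coe_injective.ne_iff
    rw [this]
    tauto

end GreeneKleitman

section Necessity

variable {V W : Type*} [Fintype V] [Fintype W] {G : SimpleGraph V} {H : SimpleGraph W}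

theorem alphak_le_of_iso (e : G ≃g H) (k : ℕ) : alphak G k ≤ alphak H k := by
  obtain ⟨A, hA, h⟩ := exists_ncard_iUnion_eq_alphak G k
  have hB : ∀ i, IndepSet H (e '' A i) := by
    rintro i _ ⟨v, hv, rfl⟩ _ ⟨w, hw, rfl⟩
    rw [e.map_adj_iff]
    exact hA i hv hw
  have := ncard_iUnion_le_alphak hB
  rwa [← Set.image_iUnion, Set.ncard_image_of_injective _ e.injective, h] at this

theorem alphak_congr (e : G ≃g H) (k : ℕ) : alphak G k = alphak H k :=
  (alphak_le_of_iso e k).antisymm (alphak_le_of_iso e.symm k)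

theorem SGK.exists_saturated (hG : SGK G) {k : ℕ} (hk : 0 < k) :
    ∃ f : V → V, IsCliquePartition G f ∧ knorm f k = alphak G k ∧
      knorm f (k + 1) = alphak G (k + 1) := by
  obtain ⟨f, hf, h1, h2⟩ := hG Finset.univ k hk
  let e : (↑(Finset.univ : Finset V) : Set V) ≃ V := Equiv.subtypeUnivEquiv (by simp)
  let E : G.induce (↑(Finset.univ : Finset V) : Set V) ≃g G := ⟨e, Iff.rfl⟩
  have hpre : ∀ i, (fun v => e (f (e.symm v))) ⁻¹' {e i} = e '' (f ⁻¹' {i}) := by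
    intro i
    ext v
    rw [Equiv.image_eq_preimage_symm]
    simp
  have hnorm : ∀ j, knorm (fun v => e (f (e.symm v))) j = knorm f j := by
    intro j
    refine (Fintype.sum_equiv e _ _ fun i => ?_).symm
    rw [hpre, Set.ncard_image_of_injective _ e.injective]
  refine ⟨fun v => e (f (e.symm v)), fun i => ?_, ?_, ?_⟩
  · obtain ⟨i, rfl⟩ := e.surjective i
    rw [hpre]
    rintro _ ⟨v, hv, rfl⟩ _ ⟨w, hw, rfl⟩ hne
    exact hf i hv hw fun h => hne (congrArg e h)
  · rw [hnorm, h1, alphak_congr E]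
  · rw [hnorm, h2, alphak_congr E]

theorem knorm_succ (f : V → V) (k : ℕ) :
    knorm f (k + 1) = knorm f k + {i | k < (f ⁻¹' {i}).ncard}.ncard := by
  classical
  rw [Set.ncard_eq_toFinset_card', Set.toFinset_ofPred, Finset.card_filter, knorm, knorm,
    ← Finset.sum_add_distrib]
  refine Finset.sum_congr rfl fun i _ => ?_
  split_ifs <;> omega

theorem ncard_large_fibers_antitone (f : V → V) {k l : ℕ} (h : k ≤ l) :
    {i | l < (f ⁻¹' {i}).ncard}.ncard ≤ {i | k < (f ⁻¹' {i}).ncard}.ncard :=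
  Set.ncard_le_ncard fun _ hi => h.trans_lt hi

theorem alphak_one_le_indepNumber (G : SimpleGraph V) : alphak G 1 ≤ indepNumber G := by
  obtain ⟨A, hA, h⟩ := exists_ncard_iUnion_eq_alphak G 1
  refine le_csSup ⟨Nat.card V, ?_⟩ ⟨A 0, hA 0, ?_⟩
  · rintro n ⟨s, -, rfl⟩
    exact Set.ncard_le_card s
  · rw [← h]
    congr 1
    ext
    simp

theorem exists_ncard_eq_cliqueNumber (G : SimpleGraph V) :
    ∃ s : Set V, G.IsClique s ∧ s.ncard = cliqueNumber G := by
  refine Nat.sSup_mem (s := {n | ∃ s : Set V, G.IsClique s ∧ s.ncard = n})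
    ⟨_, ∅, by simp, rfl⟩ ⟨Nat.card V, ?_⟩
  rintro n ⟨s, -, rfl⟩
  exact Set.ncard_le_card s

theorem alphak_lt_alphak_succ {k : ℕ} (hk : k < cliqueNumber G) :
    alphak G k < alphak G (k + 1) := by
  obtain ⟨A, hA, h⟩ := exists_ncard_iUnion_eq_alphak G k
  obtain ⟨C, hC, hCc⟩ := exists_ncard_eq_cliqueNumber G
  obtain ⟨v, -, hv⟩ : ∃ v ∈ C, v ∉ ⋃ i, A i := by
    by_contra! hsub
    have := ncard_inter_iUnion_le_min hA hC
    rw [Set.inter_eq_left.2 hsub] at this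
    omega
  have hB : ∀ i, IndepSet G ((Fin.cons {v} A : Fin (k + 1) → Set V) i) := by
    intro i
    refine Fin.cases ?_ (fun i => ?_) i
    · rintro x rfl y rfl
      exact G.irrefl
    · exact hA i
  have hle := ncard_iUnion_le_alphak hB
  have hU : (⋃ i, (Fin.cons {v} A : Fin (k + 1) → Set V) i) = insert v (⋃ i, A i) := by
    ext x
    simp
  rw [hU, Set.ncard_insert_of_notMem hv, h] at hle
  exact hle

theorem PolyunsatG.alphak_concave (hS : SGK G) (hP : PolyunsatG G) {k : ℕ} (hk : 0 < k)
    (hkc : k + 2 < cliqueNumber G) :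
    alphak G (k + 2) + alphak G k + 1 ≤ 2 * alphak G (k + 1) := by
  obtain ⟨f, hf, h1, h2⟩ := hS.exists_saturated hk
  have h3 := knorm_succ f k
  have h4 := knorm_succ f (k + 1)
  have h5 := ncard_large_fibers_antitone f k.le_succ
  have h6 := alphak_le_knorm hf (k + 2)
  have h7 : knorm f (k + 2) ≠ alphak G (k + 2) := fun h =>
    hP k (k + 2) hk (by omega) (by omega) hkc (Or.inl le_rfl) ⟨f, hf, h1, h⟩
  simp only [Nat.succ_eq_add_one, add_assoc, Nat.reduceAdd] at h4 h5
  omega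

theorem PolyunsatG.alphak_gap (hS : SGK G) (hP : PolyunsatG G) (d : ℕ) :
    ∀ j, 0 < j → j + d + 2 = cliqueNumber G → alphak G j + d + 1 ≤ alphak G (j + 1) := by
  induction d with
  | zero =>
    intro j _ hjc
    exact alphak_lt_alphak_succ (by omega)
  | succ d ih =>
    intro j hj hjc
    have h1 := ih (j + 1) j.succ_pos (by omega)
    have h2 := hP.alphak_concave hS hj (by omega)
    simp only [add_assoc, Nat.reduceAdd] at h1 h2 ⊢
    omega

theorem PolyunsatG.cliqueNumber_le (hS : SGK G) (hP : PolyunsatG G) :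
    cliqueNumber G ≤ indepNumber G + 2 := by
  by_cases hc : cliqueNumber G ≤ 2
  · omega
  have h1 := hP.alphak_gap hS (cliqueNumber G - 3) 1 one_pos (by omega)
  obtain ⟨f, hf, h2, h3⟩ := hS.exists_saturated one_pos
  have h4 := knorm_succ f 0
  have h5 := knorm_succ f 1
  have h6 := ncard_large_fibers_antitone f zero_le_one
  have h7 : knorm f 0 = 0 := by simp [knorm]
  have h8 := alphak_one_le_indepNumber G
  simp only [zero_add, Nat.reduceAdd] at h1 h3 h4 h5
  omega

end Necessity

section Construction

/-- The number of vertices in the chain `i` of the block order with clique number `c`. -/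
def blockSize (c i : ℕ) : ℕ :=
  if i + 2 < c then max 3 (c - 1 - i) else if i = 0 then c else 1

/-- The strict order on pairs (block, height). -/
def BlockLt (x y : ℕ × ℕ) : Prop :=
  (x.1 = y.1 ∧ x.2 < y.2) ∨ (x.1 < y.1 ∧ x.2 ≤ 1 ∧ 1 ≤ y.2)

/-- `x` identifies `G` with the comparability graph of the block order with `a` chains. -/
structure IsBlockGraph (c a : ℕ) {W : Type*} (G : SimpleGraph W) (x : W → ℕ × ℕ) : Prop where
  inj : Function.Injective x
  fst_lt : ∀ v, (x v).1 < a
  snd_lt : ∀ v, (x v).2 < blockSize c (x v).1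
  surj : ∀ i h, i < a → h < blockSize c i → ∃ v, x v = (i, h)
  adj : ∀ v w, G.Adj v w ↔ BlockLt (x v) (x w) ∨ BlockLt (x w) (x v)

theorem exists_isBlockGraph (c a : ℕ) :
    ∃ (n : ℕ) (G : SimpleGraph (Fin n)) (x : Fin n → ℕ × ℕ), IsBlockGraph c a G x := by
  let S : Finset (ℕ × ℕ) :=
    (Finset.range a ×ˢ Finset.range (c + 3)).filter fun y => y.2 < blockSize c y.1
  let x : Fin S.card → ℕ × ℕ := fun v => (S.equivFin.symm v : S)
  refine ⟨S.card,
    { Adj := fun v w => BlockLt (x v) (x w) ∨ BlockLt (x w) (x v)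
      symm := ⟨fun v w h => h.symm⟩
      loopless := ⟨fun v h => by unfold BlockLt at h; omega⟩ }, x,
    Subtype.val_injective.comp S.equivFin.symm.injective, fun v => ?_, fun v => ?_,
    fun i h hi hh => ?_, fun v w => Iff.rfl⟩
  · have := (S.equivFin.symm v).2
    simp only [S, Finset.mem_filter, Finset.mem_product, Finset.mem_range] at this
    exact this.1.1
  · have := (S.equivFin.symm v).2
    simp only [S, Finset.mem_filter] at this
    exact this.2
  · have : (i, h) ∈ S := by
      simp only [S, Finset.mem_filter, Finset.mem_product, Finset.mem_range]
      refine ⟨⟨hi, ?_⟩, hh⟩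
      unfold blockSize at hh
      split_ifs at hh <;> omega
    exact ⟨S.equivFin ⟨(i, h), this⟩, by simp [x]⟩

namespace IsBlockGraph

variable {c a : ℕ} {W : Type*} {G : SimpleGraph W} {x : W → ℕ × ℕ}

theorem exists_coords (H : IsBlockGraph c a G x) {i h : ℕ} (hi : i < a) (hh : h < blockSize c i) :
    ∃ v, (x v).1 = i ∧ (x v).2 = h := by
  obtain ⟨v, hv⟩ := H.surj i h hi hh
  exact ⟨v, by rw [hv], by rw [hv]⟩

theorem eq_of_coords (H : IsBlockGraph c a G x) {v w : W} (h1 : (x v).1 = (x w).1)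
    (h2 : (x v).2 = (x w).2) : v = w :=
  H.inj (Prod.ext h1 h2)

theorem isComparabilityGraph (H : IsBlockGraph c a G x) : IsComparabilityGraph G := by
  refine ⟨fun v w => v = w ∨ BlockLt (x v) (x w), ?_, fun v w => ?_⟩
  · refine { refl := fun v => Or.inl rfl, trans := ?_, antisymm := ?_ }
    · rintro u v w (rfl | h) (rfl | h')
      · exact Or.inl rfl
      · exact Or.inr h'
      · exact Or.inr h
      · right
        unfold BlockLt at *
        omega
    · rintro v w (rfl | h) (h' | h')
      · rfl
      · rfl
      · exact h'.symm
      · unfold BlockLt at *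
        omega
  · have hne := fun h => G.ne_of_adj (a := v) (b := w) h
    rw [H.adj] at hne ⊢
    constructor
    · exact fun h => ⟨hne h, h.imp Or.inr Or.inr⟩
    · rintro ⟨h, (h' | h') | (h' | h')⟩
      exacts [(h h').elim, Or.inl h', (h h'.symm).elim, Or.inr h']

theorem isComparabilityGraph_compl (H : IsBlockGraph c a G x) : IsComparabilityGraph Gᶜ := by
  let L : ℕ × ℕ → ℕ × ℕ → Prop := fun y z => y.1 < z.1 ∧ (2 ≤ y.2 ∨ z.2 = 0)
  refine ⟨fun v w => v = w ∨ L (x v) (x w), ?_, fun v w => ?_⟩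
  · refine { refl := fun v => Or.inl rfl, trans := ?_, antisymm := ?_ }
    · rintro u v w (rfl | h) (rfl | h')
      · exact Or.inl rfl
      · exact Or.inr h'
      · exact Or.inr h
      · right
        simp only [L] at *
        omega
    · rintro v w (rfl | h) (h' | h')
      · rfl
      · rfl
      · exact h'.symm
      · simp only [L] at *
        omega
  · rw [SimpleGraph.compl_adj, H.adj]
    refine and_congr_right fun hne => ?_
    have h : (x v).1 = (x w).1 → (x v).2 ≠ (x w).2 := fun h1 h2 => hne (H.eq_of_coords h1 h2)
    simp only [hne, hne.symm, false_or, L]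
    unfold BlockLt
    omega

theorem cliqueNumber_eq [Fintype W] (H : IsBlockGraph c a G x) (hc : 0 < c) (ha : 0 < a)
    (hca : c ≤ a + 2) : cliqueNumber G = c := by
  have hle : ∀ n ∈ {n | ∃ s : Set W, G.IsClique s ∧ s.ncard = n}, n ≤ c := by
    rintro _ ⟨s, hs, rfl⟩
    let ρ : W → ℕ := fun v => if (x v).2 = 0 then 0 else (x v).1 + (x v).2
    calc s.ncard ≤ (Set.Iio c).ncard := by
          refine Set.ncard_le_ncard_of_injOn ρ (fun v _ => ?_) (fun v hv w hw h => ?_)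
            (Set.finite_Iio c)
          · have := H.snd_lt v
            simp only [blockSize] at this
            simp only [ρ, Set.mem_Iio]
            split_ifs at this ⊢ <;> omega
          · by_contra hne
            have := (H.adj v w).1 (hs hv hw hne)
            simp only [ρ, BlockLt] at this h
            split_ifs at h <;> omega
      _ = c := by simp
  refine le_antisymm (csSup_le ⟨0, ∅, by simp, by simp⟩ hle) (le_csSup ⟨c, hle⟩ ?_)
  let i : ℕ → ℕ := fun t => if c ≤ 2 then 0 else if t + 1 = c then c - 3 else t - 1
  let h : ℕ → ℕ := fun t => if c ≤ 2 then t else if t = 0 then 0 else if t + 1 = c then 2 else 1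
  have hy : ∀ t : Fin c, ∃ v, x v = (i t, h t) := by
    intro t
    have := t.2
    refine H.surj _ _ ?_ ?_
    · simp only [i]
      split_ifs <;> omega
    · simp only [i, h, blockSize]
      split_ifs <;> omega
  have hlt : ∀ s t : Fin c, s < t → BlockLt (i s, h s) (i t, h t) := by
    intro s t hst
    have := t.2
    have : s.1 < t.1 := hst
    simp only [i, h, BlockLt]
    split_ifs <;> omega
  choose z hz using hy
  have hadj : ∀ s t, s ≠ t → G.Adj (z s) (z t) := by
    intro s t hst
    rw [H.adj, hz, hz]
    exact (lt_or_gt_of_ne hst).imp (hlt s t) (hlt t s)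
  refine ⟨Set.range z, ?_, ?_⟩
  · rintro _ ⟨s, rfl⟩ _ ⟨t, rfl⟩ hne
    exact hadj s t fun h => hne (congrArg z h)
  · rw [← Set.image_univ, Set.ncard_image_of_injective]
    · simp
    · intro s t h
      by_contra hne
      exact (hadj s t hne).ne h

theorem indepNumber_eq (H : IsBlockGraph c a G x) (hc : 0 < c) : indepNumber G = a := by
  have hle : ∀ n ∈ {n | ∃ s : Set W, IndepSet G s ∧ s.ncard = n}, n ≤ a := by
    rintro _ ⟨s, hs, rfl⟩
    calc s.ncard ≤ (Set.Iio a).ncard := by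
          refine Set.ncard_le_ncard_of_injOn (fun v => (x v).1) (fun v _ => H.fst_lt v)
            (fun v hv w hw h => ?_) (Set.finite_Iio a)
          have := hs hv hw
          rw [H.adj] at this
          simp only [BlockLt] at this h
          exact H.eq_of_coords h (by omega)
      _ = a := by simp
  refine le_antisymm (csSup_le ⟨0, ∅, fun _ h => h.elim, by simp⟩ hle) (le_csSup ⟨a, hle⟩ ?_)
  have hy : ∀ t : Fin a, ∃ v, x v = (t.1, 0) := fun t => H.surj _ _ t.2 (by
    simp only [blockSize]
    split_ifs <;> omega)
  choose z hz using hy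
  refine ⟨Set.range z, ?_, ?_⟩
  · rintro _ ⟨s, rfl⟩ _ ⟨t, rfl⟩
    rw [H.adj, hz, hz]
    simp only [BlockLt]
    omega
  · rw [← Set.image_univ, Set.ncard_image_of_injective]
    · simp
    · intro s t h
      have := hz s
      rw [h, hz] at this
      ext
      simpa using this.symm

/-- The level function of a maximum `k`-family, the `k`-family being the levels below `k`. -/
def level (c : ℕ) (y : ℕ × ℕ) : ℕ :=
  if y.2 = 0 then 0 else if y.2 = 1 then c - 1 - y.1 else y.2 - 1

/-- The level function of a second maximum `k`-family. -/
def shiftedLevel (c k : ℕ) (y : ℕ × ℕ) : ℕ :=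
  if y.1 + k + 2 < c then if y.2 ≤ 1 then k else y.2 - 2 else level c y

/-- The clique partition into the chains, with labels shifted by one, and a transversal clique
with label `0` that starts in the chain `c - 2 - k`. -/
def cliqueLabel (c k : ℕ) (y : ℕ × ℕ) : ℕ :=
  if (y.2 = 1 ∧ c - 2 - k ≤ y.1) ∨ (y.1 = c - 2 - k ∧ y.2 = 0) ∨ (y.1 + 3 = c ∧ 2 ≤ y.2) then 0
  else y.1 + 1

theorem level_eq_not_adj (H : IsBlockGraph c a G x) (hc : 3 ≤ c) {v w : W}
    (h : level c (x v) = level c (x w)) : ¬ G.Adj v w := by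
  have hv := H.snd_lt v
  have hw := H.snd_lt w
  rw [H.adj]
  simp only [level, blockSize, BlockLt] at *
  split_ifs at hv hw h <;> omega

theorem shiftedLevel_eq_not_adj (H : IsBlockGraph c a G x) (hc : 3 ≤ c) {k : ℕ} {v w : W}
    (h : shiftedLevel c k (x v) = shiftedLevel c k (x w)) (hk : shiftedLevel c k (x v) < k) :
    ¬ G.Adj v w := by
  have hv := H.snd_lt v
  have hw := H.snd_lt w
  rw [H.adj]
  simp only [shiftedLevel, level, blockSize, BlockLt] at *
  split_ifs at hv hw h hk <;> omega

theorem cliqueLabel_lt (H : IsBlockGraph c a G x) (k : ℕ) (v : W) :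
    cliqueLabel c k (x v) < a + 1 := by
  have := H.fst_lt v
  unfold cliqueLabel
  split_ifs <;> omega

theorem adj_of_cliqueLabel_eq (H : IsBlockGraph c a G x) {k : ℕ} (hc : 3 ≤ c) (hk : 0 < k)
    {v w : W} (h : cliqueLabel c k (x v) = cliqueLabel c k (x w)) (hne : v ≠ w) : G.Adj v w := by
  have h' : (x v).1 = (x w).1 → (x v).2 ≠ (x w).2 := fun h1 h2 => hne (H.eq_of_coords h1 h2)
  have hv := H.snd_lt v
  have hw := H.snd_lt w
  rw [H.adj]
  simp only [cliqueLabel, blockSize, BlockLt] at *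
  split_ifs at h hv hw <;> omega

theorem level_certificate (H : IsBlockGraph c a G x) (hc : 3 ≤ c) (hca : c ≤ a + 2) {k : ℕ}
    (hk : 0 < k) (hkc : k < c) (i : ℕ) :
    (∀ v, cliqueLabel c k (x v) = i → level c (x v) < k) ∨
      ∀ p < k, ∃ v, cliqueLabel c k (x v) = i ∧ level c (x v) = p := by
  rcases Nat.eq_zero_or_pos i with rfl | hi
  · right
    intro p hp
    let j := if p = 0 then c - 2 - k else if p = 1 then c - 3 else c - 1 - p
    let h := if p = 0 then 0 else if p = 1 then 2 else 1
    obtain ⟨v, hv1, hv2⟩ := H.exists_coords (i := j) (h := h) (by simp only [j]; split_ifs <;> omega)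
      (by simp only [j, h, blockSize]; split_ifs <;> omega)
    simp only [j, h] at hv1 hv2
    refine ⟨v, ?_, ?_⟩ <;> simp only [cliqueLabel, level] <;> split_ifs at * <;> omega
  · by_cases hid : i + k + 1 < c
    · right
      intro p hp
      obtain ⟨v, hv1, hv2⟩ := H.exists_coords (i := i - 1) (h := if p = 0 then 0 else p + 1) (by omega)
        (by simp only [blockSize]; split_ifs <;> omega)
      refine ⟨v, ?_, ?_⟩ <;> simp only [cliqueLabel, level] <;> split_ifs at * <;> omega
    · left
      intro v h
      have hv := H.snd_lt v
      simp only [cliqueLabel, level, blockSize] at *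
      split_ifs at hv h ⊢ <;> omega

theorem shiftedLevel_certificate (H : IsBlockGraph c a G x) (hc : 3 ≤ c) (hca : c ≤ a + 2) {k : ℕ}
    (hk : 0 < k) (hkc : k < c) (i : ℕ) :
    (∀ v, cliqueLabel c k (x v) = i → shiftedLevel c k (x v) < k) ∨
      ∀ p < k, ∃ v, cliqueLabel c k (x v) = i ∧ shiftedLevel c k (x v) = p := by
  have hshift : ∀ v, ¬ (x v).1 + k + 2 < c → shiftedLevel c k (x v) = level c (x v) :=
    fun v hv => by simp [shiftedLevel, hv]
  by_cases hid : 0 < i ∧ i + k + 1 < c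
  · right
    intro p hp
    obtain ⟨v, hv1, hv2⟩ := H.exists_coords (i := i - 1) (h := p + 2) (by omega)
      (by simp only [blockSize]; split_ifs <;> omega)
    refine ⟨v, ?_, ?_⟩ <;> simp only [cliqueLabel, shiftedLevel] <;> split_ifs <;> omega
  · have hlate : ∀ v, cliqueLabel c k (x v) = i → shiftedLevel c k (x v) = level c (x v) := by
      refine fun v h => hshift v ?_
      simp only [cliqueLabel] at h
      split_ifs at h <;> omega
    refine (H.level_certificate hc hca hk hkc i).imp (fun h v hv => ?_) fun h p hp => ?_
    · exact (hlate v hv).trans_lt (h v hv)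
    · obtain ⟨v, hv, hvp⟩ := h p hp
      exact ⟨v, hv, (hlate v hv).trans hvp⟩

theorem not_saturated (H : IsBlockGraph c a G x) [Fintype W] (hca : c ≤ a + 2) {k l : ℕ}
    (hk : 0 < k) (hkl : k + 2 ≤ l) (hl : l < c) {f : W → W} (hf : IsCliquePartition G f)
    (hfk : knorm f k = alphak G k) : knorm f l ≠ alphak G l := by
  intro hfl
  have hc : 3 ≤ c := by omega
  have hlabel : ∀ {j}, 0 < j → ∀ i : Fin (a + 1),
      G.IsClique ((fun v => (⟨_, H.cliqueLabel_lt j v⟩ : Fin (a + 1))) ⁻¹' {i}) := by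
    intro j hj i v hv w hw hne
    exact H.adj_of_cliqueLabel_eq hc hj (congrArg Fin.val (hv.trans hw.symm)) hne
  obtain ⟨v, hv1, hv2⟩ := H.exists_coords (i := c - 1 - l) (h := 1) (by omega)
    (by simp only [blockSize]; split_ifs <;> omega)
  have hit : ∀ p < l, ∃ w, f w = f v ∧ level c (x w) = p := fun p hp =>
    exists_level_of_saturated (lev := fun v => level c (x v))
      (fun v w h _ => H.level_eq_not_adj hc h) (hlabel (by omega : 0 < l))
      (fun i => by simpa only [Fin.ext_iff] using H.level_certificate hc hca (by omega) hl i)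
      hf hfl (by simp only [level]; split_ifs <;> omega) hp
  have hcomp : ∀ {u w}, f u = f v → f w = f v → x u = x w ∨ BlockLt (x u) (x w) ∨
      BlockLt (x w) (x u) := by
    intro u w hu hw
    rw [← H.adj]
    by_cases h : u = w
    · exact Or.inl (congrArg x h)
    · exact Or.inr (hf (f v) hu hw h)
  obtain ⟨u, hu, hu0⟩ := hit 0 (by omega)
  obtain ⟨w, hw, hw1⟩ := hit 1 (by omega)
  obtain ⟨z, hz, hz0⟩ : ∃ w, f w = f v ∧ shiftedLevel c k (x w) = 0 :=
    exists_level_of_saturated (lev := fun v => shiftedLevel c k (x v))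
      (fun v w h h' => H.shiftedLevel_eq_not_adj hc h h') (hlabel hk)
      (fun i => by
        simpa only [Fin.ext_iff] using H.shiftedLevel_certificate hc hca hk (by omega) i)
      hf hfk (by simp only [shiftedLevel]; split_ifs <;> omega) hk
  have hvu := hcomp rfl hu
  have hvw := hcomp rfl hw
  have huz := hcomp hu hz
  have hwz := hcomp hw hz
  have hsu := H.snd_lt u
  have hsw := H.snd_lt w
  have hsz := H.snd_lt z
  have hu' : (x u).2 = 0 := by
    simp only [level, blockSize] at hu0 hsu
    split_ifs at hu0 hsu <;> omega
  have hw' : (x w).2 = 2 := by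
    simp only [level, blockSize] at hw1 hsw
    split_ifs at hw1 hsw <;> omega
  simp only [BlockLt, Prod.ext_iff] at hvu hvw huz hwz
  have hlast : (x w).1 + 3 = c := by
    by_contra hne
    have : (x w).1 + 3 < c := by
      simp only [blockSize] at hsw
      split_ifs at hsw <;> omega
    obtain ⟨y, hy, hyp⟩ := hit (c - 2 - (x w).1) (by omega)
    have hwy := hcomp hw hy
    have hsy := H.snd_lt y
    simp only [BlockLt, Prod.ext_iff, level, blockSize] at hwy hsy hyp
    split_ifs at hyp hsy <;> omega
  simp only [shiftedLevel, level, blockSize] at hz0 hsz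
  split_ifs at hz0 hsz <;> omega

theorem polyunsatG (H : IsBlockGraph c a G x) [Fintype W] (hc : 0 < c) (ha : 0 < a)
    (hca : c ≤ a + 2) : PolyunsatG G := by
  intro k l hk hl hkc hlc hkl
  rw [H.cliqueNumber_eq hc ha hca] at hkc hlc
  rintro ⟨f, hf, hfk, hfl⟩
  rcases hkl with h | h
  · exact H.not_saturated hca hk h hlc hf hfk hfl
  · exact H.not_saturated hca hl h hkc hf hfl hfk

end IsBlockGraph

end Construction

/-- For positive integers `c` and `a`: there is a polyunsaturated SGK graph with clique
number `c` and independence number `a` iff `a ≥ c - 2`; moreover, in that case the graph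
may be chosen so that it and its complement are comparability graphs. -/
theorem statement13 (c a : ℕ) (hc : 0 < c) (ha : 0 < a) :
    ((∃ (n : ℕ) (G : SimpleGraph (Fin n)),
        SGK G ∧ PolyunsatG G ∧ cliqueNumber G = c ∧ indepNumber G = a) ↔
      c ≤ a + 2) ∧
    (c ≤ a + 2 →
      ∃ (n : ℕ) (G : SimpleGraph (Fin n)),
        SGK G ∧ PolyunsatG G ∧ cliqueNumber G = c ∧ indepNumber G = a ∧
        IsComparabilityGraph G ∧ IsComparabilityGraph Gᶜ) := by
  have hsuff : c ≤ a + 2 →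
      ∃ (n : ℕ) (G : SimpleGraph (Fin n)),
        SGK G ∧ PolyunsatG G ∧ cliqueNumber G = c ∧ indepNumber G = a ∧
        IsComparabilityGraph G ∧ IsComparabilityGraph Gᶜ := by
    intro hca
    obtain ⟨n, G, x, H⟩ := exists_isBlockGraph c a
    exact ⟨n, G, H.isComparabilityGraph.sgk, H.polyunsatG hc ha hca, H.cliqueNumber_eq hc ha hca,
      H.indepNumber_eq hc, H.isComparabilityGraph, H.isComparabilityGraph_compl⟩
  refine ⟨⟨?_, fun hca => ?_⟩, hsuff⟩
  · rintro ⟨n, G, hS, hP, rfl, rfl⟩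
    exact hP.cliqueNumber_le hS
  · obtain ⟨n, G, hS, hP, h1, h2, -⟩ := hsuff hca
    exact ⟨n, G, hS, hP, h1, h2⟩
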